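/- Gallager random-coding bound (supporting result for the error-exponent theorem): Let P_X be a probability distribution on a measurable input space 𝒳 and P_{Y|X} a Markov kernel to a measurable output space 𝒴 such that each P_{Y|X=x} has density p(y|x) with respect to a common σ-finite reference measure ν on 𝒴. Then for every integer M ≥ 2 and every μ ∈ [0,1], there exists a code with M equiprobable messages whose average error probability ε̄ satisfies ε̄ ≤ (M−1)^μ · ∫_𝒴 ( E_{X∼P_X}[ p(y|X)^{1/(1+μ)} ] )^{1+μ} dν(y). -/

import Mathlib

open MeasureTheory ProbabilityTheory
open scoped ENNReal BigOperators

/-- Jensen's inequality for concave powers of `ℝ≥0∞`-valued functions. -/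
lemma lintegral_rpow_le_rpow_lintegral {Ω : Type*} [MeasurableSpace Ω]
    (P : Measure Ω) [IsProbabilityMeasure P] (F : Ω → ℝ≥0∞) (hF : Measurable F)
    (s : ℝ) (hs0 : 0 ≤ s) (hs1 : s ≤ 1) :
    ∫⁻ ω, F ω ^ s ∂P ≤ (∫⁻ ω, F ω ∂P) ^ s := by
  rcases hs0.eq_or_lt with rfl | hs
  · simp
  have h := eLpNorm'_le_eLpNorm'_of_exponent_le hs hs1 P hF.aestronglyMeasurable
  simp only [eLpNorm', enorm_eq_self, ENNReal.rpow_one, one_div, inv_one] at h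
  have h2 := ENNReal.rpow_le_rpow h hs.le
  rwa [← ENNReal.rpow_mul, inv_mul_cancel₀ hs.ne', ENNReal.rpow_one] at h2

/-- A measurable maximum-likelihood decoder. -/
lemma exists_measurable_argmax {𝒴 : Type*} [MeasurableSpace 𝒴] (n : ℕ)
    (q : Fin (n + 1) → 𝒴 → ℝ≥0∞) (hq : ∀ j, Measurable (q j)) :
    ∃ g : 𝒴 → Fin (n + 1), Measurable g ∧ ∀ y j, q j y ≤ q (g y) y := by
  classical
  have hex : ∀ y, ∃ N : ℕ, ∀ j, q j y ≤ q (Fin.ofNat (n + 1) N) y := by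
    intro y
    obtain ⟨i, hi⟩ := Finite.exists_max (fun j => q j y)
    refine ⟨i, fun j => ?_⟩
    have : Fin.ofNat (n + 1) (i : ℕ) = i := by
      ext; simp [Fin.ofNat, Nat.mod_eq_of_lt i.isLt]
    rw [this]; exact hi j
  refine ⟨fun y => Fin.ofNat (n + 1) (Nat.find (hex y)), ?_, fun y => Nat.find_spec (hex y)⟩
  refine (measurable_from_top (f := fun N : ℕ => Fin.ofNat (n + 1) N)).comp
    (measurable_find hex fun k => ?_)
  simp only [Set.ofPred_forall]
  exact MeasurableSet.iInter fun j => measurableSet_le (hq j) (hq _)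

/-- Averaging over the random codebook for a fixed output. -/
lemma lintegral_pi_le {𝒳 : Type*} [MeasurableSpace 𝒳] (PX : Measure 𝒳)
    [IsProbabilityMeasure PX] (n : ℕ) (F : 𝒳 → ℝ≥0∞) (hF : Measurable F)
    (μ : ℝ) (hμ0 : 0 ≤ μ) (hμ1 : μ ≤ 1) (j : Fin (n + 1)) :
    ∫⁻ f : Fin (n + 1) → 𝒳, F (f j) * (∑ k, F (f (j.succAbove k))) ^ μ
        ∂(Measure.pi fun _ => PX) ≤
      (n : ℝ≥0∞) ^ μ * (∫⁻ x, F x ∂PX) ^ (1 + μ) := by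
  have hmp := measurePreserving_piFinSuccAbove (fun _ : Fin (n + 1) => PX) j
  have h1 := hmp.lintegral_comp
    (f := fun z : 𝒳 × (Fin n → 𝒳) => F z.1 * (∑ k, F (z.2 k)) ^ μ) (by fun_prop)
  have h2 : ∫⁻ f : Fin (n + 1) → 𝒳, F (f j) * (∑ k, F (f (j.succAbove k))) ^ μ
        ∂(Measure.pi fun _ => PX) = 
      ∫⁻ z : 𝒳 × (Fin n → 𝒳), F z.1 * (∑ k, F (z.2 k)) ^ μ
        ∂(PX.prod (Measure.pi fun _ => PX)) := h1
  rw [h2, lintegral_prod_mul (f := F) (g := fun z : Fin n → 𝒳 => (∑ k, F (z k)) ^ μ)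
    hF.aemeasurable
    (Measurable.aemeasurable (by fun_prop))]
  have h3 : ∫⁻ z : Fin n → 𝒳, (∑ k, F (z k)) ^ μ ∂(Measure.pi fun _ => PX) ≤
      ((n : ℝ≥0∞) * ∫⁻ x, F x ∂PX) ^ μ := by
    refine (lintegral_rpow_le_rpow_lintegral _ _ (by fun_prop) μ hμ0 hμ1).trans_eq ?_
    rw [lintegral_finsetSum _ (by fun_prop)]
    have h4 : ∀ k : Fin n, ∫⁻ z : Fin n → 𝒳, F (z k) ∂(Measure.pi fun _ => PX) =
        ∫⁻ x, F x ∂PX := fun k =>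
      (measurePreserving_eval (fun _ : Fin n => PX) k).lintegral_comp hF
    simp [h4]
  calc _ ≤ (∫⁻ x, F x ∂PX) * ((n : ℝ≥0∞) * ∫⁻ x, F x ∂PX) ^ μ := by gcongr
    _ = _ := by
      rw [ENNReal.mul_rpow_of_nonneg _ _ hμ0,
        ENNReal.rpow_add_of_nonneg _ _ zero_le_one hμ0, ENNReal.rpow_one]
      ring

/-- Gallager random-coding bound: if each channel output law
`P_{Y|X=x}` has density `p(·|x)` with respect to a common σ-finite measure `ν`,
then for every `M ≥ 2` and every `μ ∈ [0,1]` there is a code with `M` messages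
whose average error probability satisfies
`ε̄ ≤ (M−1)^μ ∫ (E_{X}[p(y|X)^{1/(1+μ)}])^{1+μ} dν(y)`. -/
theorem gallager_bound
    {𝒳 𝒴 : Type*} [MeasurableSpace 𝒳] [MeasurableSpace 𝒴]
    [StandardBorelSpace 𝒳] [StandardBorelSpace 𝒴]
    (PX : Measure 𝒳) [IsProbabilityMeasure PX]
    (κ : Kernel 𝒳 𝒴) [IsMarkovKernel κ]
    (ν : Measure 𝒴) [SigmaFinite ν]
    (p : 𝒳 → 𝒴 → ℝ)
    (hp_meas : Measurable (Function.uncurry p))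
    (hp_nonneg : ∀ x y, 0 ≤ p x y)
    (hκ : ∀ x, κ x = ν.withDensity fun y => ENNReal.ofReal (p x y))
    (M : ℕ) (hM : 2 ≤ M) (μ : ℝ) (hμ0 : 0 ≤ μ) (hμ1 : μ ≤ 1) :
    ∃ (f : Fin M → 𝒳) (g : 𝒴 → Fin M), Measurable g ∧
      (1 / M : ℝ) * ∑ j, ((κ (f j)) {y | g y ≠ j}).toReal ≤
        ((M : ℝ) - 1) ^ μ *
          ∫ y, (∫ x, p x y ^ (1 / (1 + μ)) ∂PX) ^ (1 + μ) ∂ν := by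
  obtain ⟨n, rfl⟩ : ∃ n, M = n + 1 := ⟨M - 1, by omega⟩
  have h1μ : 0 < 1 + μ := by linarith
  set s : ℝ := 1 / (1 + μ) with hs
  have hs0 : 0 < s := by positivity
  have hs1 : s ≤ 1 := by rw [hs, div_le_one h1μ]; linarith
  have hsμ : s * (1 + μ) = 1 := by rw [hs]; field_simp
  set q : 𝒳 → 𝒴 → ℝ≥0∞ := fun x y => ENNReal.ofReal (p x y) with hq
  have hqm : Measurable (Function.uncurry q) := hp_meas.ennreal_ofReal
  have hqx : ∀ x, Measurable (q x) := fun x => hqm.comp measurable_prodMk_left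
  have hqy : ∀ y, Measurable (fun x => q x y) := fun y => hqm.comp measurable_prodMk_right
  set A : 𝒴 → ℝ≥0∞ := fun y => ∫⁻ x, q x y ^ s ∂PX with hA
  have hAm : Measurable A :=
    Measurable.lintegral_prod_left' (f := fun z : 𝒳 × 𝒴 => q z.1 z.2 ^ s) (hqm.pow_const s)
  have hBle : ∫⁻ y, A y ^ (1 + μ) ∂ν ≤ 1 := by
    calc ∫⁻ y, A y ^ (1 + μ) ∂ν ≤ ∫⁻ y, ∫⁻ x, q x y ∂PX ∂ν := by
          refine lintegral_mono fun y => ?_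
          have := lintegral_rpow_le_rpow_lintegral PX _ (hqy y) s hs0.le hs1
          have := ENNReal.rpow_le_rpow this h1μ.le
          rwa [← ENNReal.rpow_mul, hsμ, ENNReal.rpow_one] at this
      _ = ∫⁻ x, ∫⁻ y, q x y ∂ν ∂PX := (lintegral_lintegral_swap hqm.aemeasurable).symm
      _ = ∫⁻ x, 1 ∂PX := by
          refine lintegral_congr fun x => ?_
          have := measure_univ (μ := κ x)
          rwa [hκ, withDensity_apply _ MeasurableSet.univ, Measure.restrict_univ] at this
      _ = 1 := by simp
  have hBfin : ∫⁻ y, A y ^ (1 + μ) ∂ν ≠ ∞ := (hBle.trans_lt ENNReal.one_lt_top).ne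
  have hreal : ∫ y, (∫ x, p x y ^ s ∂PX) ^ (1 + μ) ∂ν = (∫⁻ y, A y ^ (1 + μ) ∂ν).toReal := by
    rw [← integral_toReal (hAm.pow_const _).aemeasurable
      (ae_lt_top (hAm.pow_const _) hBfin)]
    congr 1
    ext y
    have hpy : Measurable fun x => p x y := hp_meas.comp measurable_prodMk_right
    rw [integral_eq_lintegral_of_nonneg_ae
      (Filter.Eventually.of_forall fun x => Real.rpow_nonneg (hp_nonneg x y) s)
      (hpy.pow_const s).aestronglyMeasurable, ← ENNReal.toReal_rpow]
    congr 2
    refine lintegral_congr fun x => ?_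
    exact (ENNReal.ofReal_rpow_of_nonneg (hp_nonneg x y) hs0.le).symm
  -- the random coding functional
  let T : (Fin (n + 1) → 𝒳) → Fin (n + 1) → 𝒴 → ℝ≥0∞ := fun f j y =>
    q (f j) y ^ s * (∑ k, q (f (j.succAbove k)) y ^ s) ^ μ
  have hqf : ∀ j : Fin (n + 1),
      Measurable fun z : (Fin (n + 1) → 𝒳) × 𝒴 => q (z.1 j) z.2 := fun j =>
    hqm.comp (g := Function.uncurry q)
      (f := fun z : (Fin (n + 1) → 𝒳) × 𝒴 => (z.1 j, z.2)) (by fun_prop)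
  have hTm : ∀ j, Measurable fun z : (Fin (n + 1) → 𝒳) × 𝒴 => T z.1 j z.2 := by
    intro j
    exact ((hqf j).pow_const s).mul
      ((Finset.measurable_sum _ fun k _ => (hqf (j.succAbove k)).pow_const s).pow_const μ)
  have hTI : ∀ j, Measurable fun f => ∫⁻ y, T f j y ∂ν := fun j =>
    (hTm j).lintegral_prod_right'
  obtain ⟨f, hf⟩ := exists_le_lintegral (μ := Measure.pi fun _ : Fin (n + 1) => PX)
    (f := fun f => ∑ j, ∫⁻ y, T f j y ∂ν)
    (Finset.measurable_sum _ fun j _ => hTI j).aemeasurable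
  have hbound : ∑ j, ∫⁻ y, T f j y ∂ν ≤
      ((n + 1 : ℕ) : ℝ≥0∞) * ((n : ℝ≥0∞) ^ μ * ∫⁻ y, A y ^ (1 + μ) ∂ν) := by
    refine hf.trans ?_
    rw [lintegral_finsetSum _ (fun j _ => hTI j)]
    have : ∀ j, ∫⁻ f, ∫⁻ y, T f j y ∂ν ∂(Measure.pi fun _ : Fin (n + 1) => PX) ≤
        (n : ℝ≥0∞) ^ μ * ∫⁻ y, A y ^ (1 + μ) ∂ν := by
      intro j
      rw [lintegral_lintegral_swap (hTm j).aemeasurable,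
        ← lintegral_const_mul _ (hAm.pow_const _)]
      refine lintegral_mono fun y => ?_
      exact lintegral_pi_le PX n (fun x => q x y ^ s) ((hqy y).pow_const s) μ hμ0 hμ1 j
    refine (Finset.sum_le_sum fun j _ => this j).trans_eq ?_
    simp
  obtain ⟨g, hgm, hg⟩ := exists_measurable_argmax n (fun j y => q (f j) y) (fun j => hqx (f j))
  refine ⟨f, g, hgm, ?_⟩
  have herr : ∀ j, κ (f j) {y | g y ≠ j} ≤ ∫⁻ y, T f j y ∂ν := by
    intro j
    have hms : MeasurableSet {y | g y ≠ j} := (hgm (measurableSet_singleton j)).compl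
    rw [hκ, withDensity_apply _ hms]
    refine (setLIntegral_mono' hms fun y hy => ?_).trans (setLIntegral_le_lintegral _ _)
    obtain ⟨k, hk⟩ := Fin.exists_succAbove_eq (show g y ≠ j from hy)
    have h1 : q (f j) y ^ s ≤ ∑ k, q (f (j.succAbove k)) y ^ s := by
      calc q (f j) y ^ s ≤ q (f (j.succAbove k)) y ^ s := by
            rw [hk]; exact ENNReal.rpow_le_rpow (hg y j) hs0.le
        _ ≤ _ := Finset.single_le_sum (f := fun k => q (f (j.succAbove k)) y ^ s)
            (fun _ _ => zero_le) (Finset.mem_univ k)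
    calc q (f j) y = q (f j) y ^ s * (q (f j) y ^ s) ^ μ := by
          rw [← ENNReal.rpow_mul, ← ENNReal.rpow_add_of_nonneg _ _ hs0.le (by positivity)]
          rw [show s + s * μ = 1 by linarith, ENNReal.rpow_one]
      _ ≤ T f j y := by
          exact mul_le_mul_right (ENNReal.rpow_le_rpow h1 hμ0) _
  have htot : ∑ j, κ (f j) {y | g y ≠ j} ≤
      ((n + 1 : ℕ) : ℝ≥0∞) * ((n : ℝ≥0∞) ^ μ * ∫⁻ y, A y ^ (1 + μ) ∂ν) :=
    (Finset.sum_le_sum fun j _ => herr j).trans hbound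
  have hfin : ((n + 1 : ℕ) : ℝ≥0∞) * ((n : ℝ≥0∞) ^ μ * ∫⁻ y, A y ^ (1 + μ) ∂ν) ≠ ∞ :=
    ENNReal.mul_ne_top (ENNReal.natCast_ne_top _)
      (ENNReal.mul_ne_top (ENNReal.rpow_ne_top_of_nonneg hμ0 (ENNReal.natCast_ne_top _)) hBfin)
  have h := ENNReal.toReal_mono hfin htot
  rw [ENNReal.toReal_sum (fun j _ => measure_ne_top _ _), ENNReal.toReal_mul,
    ENNReal.toReal_mul, ← ENNReal.toReal_rpow, ENNReal.toReal_natCast,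
    ENNReal.toReal_natCast] at h
  rw [hreal]
  have hn : (((n + 1 : ℕ) : ℝ) - 1) = n := by push_cast; ring
  rw [hn, one_div, inv_mul_le_iff₀ (by positivity)]
  exact h
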